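/- Let f belong to CW²_Δ[−1,1] with constant M₂. Then for every x ∈ (−1,1) the Cauchy principal value R_N(f,x) = J(f − S_N, x) exists and satisfies |R_N(f,x)| ≤ (γ²M₂/(2π))·(1 + π·√(24π)/(γ·ln N))·(ln N)/N². -/

import Mathlib

open Real MeasureTheory Filter Topology

theorem le_quadratic_of_lipschitz_deriv {a b M : ℝ} {φ p : ℝ → ℝ}
    (hφ : ∀ u ∈ Set.Icc a b, HasDerivWithinAt φ (p u) (Set.Icc a b) u)
    (hp : ∀ u ∈ Set.Icc a b, ∀ v ∈ Set.Icc a b, |p u - p v| ≤ M * |u - v|)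
    (ha : φ a = 0) (hb : φ b = 0) {u : ℝ} (hu : u ∈ Set.Icc a b) :
    φ u ≤ M / 2 * ((u - a) * (b - u)) := by
  have hd : ∀ v ∈ Set.Ioo a b, HasDerivAt (fun v => φ v - M / 2 * ((v - a) * (b - v)))
      (p v - M / 2 * (a + b - 2 * v)) v := by
    intro v hv
    have h1 := (hφ v (Set.Ioo_subset_Icc_self hv)).hasDerivAt (Icc_mem_nhds hv.1 hv.2)
    have h2 := (((hasDerivAt_id v).sub_const a).mul ((hasDerivAt_id v).const_sub b)).const_mul
      (M / 2)
    refine (h1.sub h2).congr_deriv ?_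
    simp only [id]
    ring
  have hconv : ConvexOn ℝ (Set.Icc a b) (fun v => φ v - M / 2 * ((v - a) * (b - v))) := by
    apply MonotoneOn.convexOn_of_deriv (convex_Icc a b)
    · exact ContinuousOn.sub (fun v hv => (hφ v hv).continuousWithinAt) (by fun_prop)
    · rw [interior_Icc]
      exact fun v hv => (hd v hv).differentiableAt.differentiableWithinAt
    · rw [interior_Icc]
      intro v hv w hw hvw
      rw [(hd v hv).deriv, (hd w hw).deriv]
      have h := hp v (Set.Ioo_subset_Icc_self hv) w (Set.Ioo_subset_Icc_self hw)
      rw [abs_sub_comm v w, abs_of_nonneg (sub_nonneg.2 hvw)] at h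
      have := (abs_le.1 h).2
      linarith
  have hab : a ≤ b := hu.1.trans hu.2
  have := hconv.le_max_of_mem_Icc (Set.left_mem_Icc.2 hab) (Set.right_mem_Icc.2 hab) hu
  simp only [ha, hb, sub_self, zero_mul, mul_zero, max_self] at this
  linarith

theorem abs_le_of_lipschitz_deriv {a b M : ℝ} (hM : 0 ≤ M) {φ p : ℝ → ℝ}
    (hφ : ∀ u ∈ Set.Icc a b, HasDerivWithinAt φ (p u) (Set.Icc a b) u)
    (hp : ∀ u ∈ Set.Icc a b, ∀ v ∈ Set.Icc a b, |p u - p v| ≤ M * |u - v|)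
    (ha : φ a = 0) (hb : φ b = 0) {u : ℝ} (hu : u ∈ Set.Icc a b) :
    |φ u| ≤ M * (b - a) ^ 2 / 8 := by
  have h1 := le_quadratic_of_lipschitz_deriv hφ hp ha hb hu
  have h2 := le_quadratic_of_lipschitz_deriv (φ := -φ) (p := -p) (fun v hv => (hφ v hv).neg)
    (fun v hv w hw => by
      have := hp v hv w hw
      rwa [← abs_neg, show -(p v - p w) = (-p) v - (-p) w by simp only [Pi.neg_apply]; ring] at this)
    (by simp [ha]) (by simp [hb]) hu
  have h3 : M / 2 * ((u - a) * (b - u)) ≤ M * (b - a) ^ 2 / 8 := by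
    nlinarith [mul_nonneg hM (sq_nonneg (2 * u - a - b))]
  simp only [Pi.neg_apply] at h2
  exact abs_le.2 ⟨by linarith, by linarith⟩

theorem abs_sub_le_of_lipschitz_deriv {a b M : ℝ} (hM : 0 ≤ M) (hab : a < b) {φ p : ℝ → ℝ}
    (hφ : ∀ u ∈ Set.Icc a b, HasDerivWithinAt φ (p u) (Set.Icc a b) u)
    (hp : ∀ u ∈ Set.Icc a b, ∀ v ∈ Set.Icc a b, |p u - p v| ≤ M * |u - v|)
    (hφab : φ a = φ b) {u v : ℝ} (hu : u ∈ Set.Icc a b) (hv : v ∈ Set.Icc a b) :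
    |φ u - φ v| ≤ M * (b - a) * |u - v| := by
  obtain ⟨c, hc, hpc⟩ := exists_hasDerivAt_eq_zero hab
    (fun w hw => (hφ w hw).continuousWithinAt) hφab
    (fun w hw => (hφ w (Set.Ioo_subset_Icc_self hw)).hasDerivAt (Icc_mem_nhds hw.1 hw.2))
  refine (convex_Icc a b).norm_image_sub_le_of_norm_hasDerivWithin_le hφ (fun w hw => ?_) hv hu
  have h := hp w hw c (Set.Ioo_subset_Icc_self hc)
  rw [hpc, sub_zero] at h
  refine h.trans (mul_le_mul_of_nonneg_left ?_ hM)
  rw [abs_le]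
  constructor <;> linarith [hw.1, hw.2, hc.1, hc.2]

theorem exists_piece_of_mem_Icc {n : ℕ} {t : ℕ → ℝ} {u : ℝ} (hn : 0 < n)
    (hu : u ∈ Set.Icc (t 0) (t n)) : ∃ k < n, u ∈ Set.Icc (t k) (t (k + 1)) := by
  induction n with
  | zero => omega
  | succ n ih =>
    rcases le_total (t n) u with h | h
    · exact ⟨n, n.lt_succ_self, h, hu.2⟩
    · rcases Nat.eq_zero_or_pos n with rfl | h0
      · exact ⟨0, hn, hu⟩
      · obtain ⟨k, hk, hku⟩ := ih h0 ⟨hu.1, h⟩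
        exact ⟨k, hk.trans n.lt_succ_self, hku⟩

theorem abs_sub_le_of_pieces {n : ℕ} {t : ℕ → ℝ} {φ : ℝ → ℝ} {L : ℝ}
    (hmono : ∀ k < n, t k < t (k + 1))
    (h : ∀ k < n, ∀ u ∈ Set.Icc (t k) (t (k + 1)), ∀ v ∈ Set.Icc (t k) (t (k + 1)),
      |φ u - φ v| ≤ L * |u - v|) :
    ∀ u ∈ Set.Icc (t 0) (t n), ∀ v ∈ Set.Icc (t 0) (t n), |φ u - φ v| ≤ L * |u - v| := by
  induction n with
  | zero =>
    intro u hu v hv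
    rw [Set.Icc_self] at hu hv
    simp [Set.mem_singleton_iff.1 hu, Set.mem_singleton_iff.1 hv]
  | succ n ih =>
    have ih' := ih (fun k hk => hmono k (by omega)) (fun k hk => h k (by omega))
    have hlast := h n (by omega)
    have h0 : t 0 ≤ t n := by
      have : ∀ m ≤ n, t 0 ≤ t m := by
        intro m
        induction m with
        | zero => intro _; rfl
        | succ m hm => intro h'; exact (hm (by omega)).trans (hmono m (by omega)).le
      exact this n le_rfl
    have h1 := hmono n (by omega)
    have cross : ∀ u ∈ Set.Icc (t 0) (t n), ∀ v ∈ Set.Icc (t n) (t (n + 1)),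
        |φ u - φ v| ≤ L * |u - v| := by
      intro u hu v hv
      have e1 := ih' u hu (t n) ⟨h0, le_rfl⟩
      have e2 := hlast (t n) ⟨le_rfl, h1.le⟩ v hv
      have e3 := abs_sub_le (φ u) (φ (t n)) (φ v)
      rw [abs_of_nonpos (sub_nonpos.2 hu.2)] at e1
      rw [abs_of_nonpos (sub_nonpos.2 hv.1)] at e2
      rw [abs_of_nonpos (sub_nonpos.2 (hu.2.trans hv.1))]
      linarith
    intro u hu v hv
    rcases le_total u (t n) with a | a <;> rcases le_total v (t n) with b | b
    · exact ih' u ⟨hu.1, a⟩ v ⟨hv.1, b⟩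
    · exact cross u ⟨hu.1, a⟩ v ⟨b, hv.2⟩
    · rw [abs_sub_comm, abs_sub_comm u]
      exact cross v ⟨hv.1, b⟩ u ⟨a, hu.2⟩
    · exact hlast u ⟨a, hu.2⟩ v ⟨b, hv.2⟩

theorem intervalIntegrable_and_integral_of_deriv_nonneg {F F' : ℝ → ℝ} {a b : ℝ} (hab : a ≤ b)
    (hF : ContinuousOn F (Set.Icc a b)) (hd : ∀ u ∈ Set.Ioo a b, HasDerivAt F (F' u) u)
    (h0 : ∀ u ∈ Set.Ioo a b, 0 ≤ F' u) :
    IntervalIntegrable F' volume a b ∧ ∫ u in a..b, F' u = F b - F a := by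
  have hi : IntervalIntegrable F' volume a b :=
    (intervalIntegrable_iff_integrableOn_Ioc_of_le hab).2
      (intervalIntegral.integrableOn_deriv_of_nonneg hF hd h0)
  exact ⟨hi, intervalIntegral.integral_eq_sub_of_hasDerivAt_of_le hab hF hd hi⟩

theorem intervalIntegrable_one_div_sqrt_one_sub_sq :
    IntervalIntegrable (fun u : ℝ => 1 / √(1 - u ^ 2)) volume (-1) 1 :=
  (intervalIntegrable_and_integral_of_deriv_nonneg (by norm_num) continuous_arcsin.continuousOn
    (fun _ hu => hasDerivAt_arcsin hu.1.ne' hu.2.ne) (fun _ _ => by positivity)).1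

theorem integral_sqrt_one_sub_div_sqrt {x v : ℝ} (hxv : x ≤ v) (hv : v ≤ 1) :
    IntervalIntegrable (fun u : ℝ => √(1 - x) / √(1 - u)) volume x v ∧
      ∫ u in x..v, √(1 - x) / √(1 - u) ≤ 2 * (v - x) := by
  obtain ⟨h1, h2⟩ := intervalIntegrable_and_integral_of_deriv_nonneg
    (F := fun u => -(2 * √(1 - x)) * √(1 - u)) (F' := fun u : ℝ => √(1 - x) / √(1 - u)) hxv
    (by fun_prop)
    (fun u hu => by
      have hu1 : 0 < 1 - u := by linarith [hu.2]
      have hs : √(1 - u) ≠ 0 := (sqrt_pos.2 hu1).ne'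
      have := ((((hasDerivAt_id u).const_sub 1)).sqrt hu1.ne').const_mul (-(2 * √(1 - x)))
      refine this.congr_deriv ?_
      simp only [id]
      field_simp) (fun _ _ => by positivity)
  refine ⟨h1, ?_⟩
  rw [h2]
  have ha := sq_sqrt (show 0 ≤ 1 - x by linarith)
  have hb := sq_sqrt (show 0 ≤ 1 - v by linarith)
  have hc : √(1 - v) ≤ √(1 - x) := sqrt_le_sqrt (by linarith)
  nlinarith [mul_nonneg (sub_nonneg.2 hc) (sqrt_nonneg (1 - v))]

theorem sqrt_div_sqrt_one_sub_sq_le {x u : ℝ} (hx : -1 < x) (hxu : x ≤ u) (hu : u ≤ 1) :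
    √(1 - x ^ 2) / √(1 - u ^ 2) ≤ √(1 - x) / √(1 - u) := by
  rcases hu.eq_or_lt with rfl | hu
  · simp
  have h1 : 0 < 1 - u := by linarith
  rw [← sqrt_div' _ (by nlinarith), ← sqrt_div' _ h1.le]
  apply sqrt_le_sqrt
  rw [div_le_div_iff₀ (by nlinarith) h1]
  have : 0 ≤ (1 - x) * (1 - u) * (u - x) :=
    mul_nonneg (mul_nonneg (by linarith) h1.le) (by linarith)
  nlinarith

/-- The denominator in the logarithmic primitive of the weighted Cauchy kernel. -/
noncomputable def cauchyDen (x u : ℝ) : ℝ := 1 - x * u + √(1 - x ^ 2) * √(1 - u ^ 2)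

theorem cauchyDen_neg (x u : ℝ) : cauchyDen (-x) (-u) = cauchyDen x u := by
  simp [cauchyDen]

theorem continuous_cauchyDen (x : ℝ) : Continuous (cauchyDen x) := by
  unfold cauchyDen
  fun_prop

theorem cauchyDen_pos {x u : ℝ} (hx : x ∈ Set.Ioo (-1 : ℝ) 1) (hu : u ∈ Set.Icc (-1 : ℝ) 1) :
    0 < cauchyDen x u := by
  have h : 0 < 1 - x * u := by
    have := hx.1; have := hx.2; have := hu.1; have := hu.2
    rcases le_total 0 u with h | h <;> nlinarith
  have : 0 ≤ √(1 - x ^ 2) * √(1 - u ^ 2) := by positivity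
  unfold cauchyDen
  linarith

theorem cauchyDen_le_two {x u : ℝ} (hx : x ∈ Set.Ioo (-1 : ℝ) 1) (hu : u ∈ Set.Icc (-1 : ℝ) 1) :
    cauchyDen x u ≤ 2 := by
  have h1 := sq_sqrt (show 0 ≤ 1 - x ^ 2 by nlinarith [hx.1, hx.2])
  have h2 := sq_sqrt (show 0 ≤ 1 - u ^ 2 by nlinarith [hu.1, hu.2])
  unfold cauchyDen
  nlinarith [sq_nonneg (√(1 - x ^ 2) - √(1 - u ^ 2)), sq_nonneg (x + u)]

theorem hasDerivAt_log_sub_log_cauchyDen {x u : ℝ} (hx : x ∈ Set.Ioo (-1 : ℝ) 1)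
    (hu : u ∈ Set.Ioo (-1 : ℝ) 1) (hxu : u ≠ x) :
    HasDerivAt (fun u => log (u - x) - log (cauchyDen x u))
      (√(1 - x ^ 2) / (√(1 - u ^ 2) * (u - x))) u := by
  have hu0 : 0 < 1 - u ^ 2 := by nlinarith [hu.1, hu.2]
  have hx0 : 0 < 1 - x ^ 2 := by nlinarith [hx.1, hx.2]
  have hD := cauchyDen_pos hx (Set.Ioo_subset_Icc_self hu)
  have h1 : HasDerivAt (cauchyDen x) (-x + √(1 - x ^ 2) * (-(2 * u) / (2 * √(1 - u ^ 2)))) u := by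
    have e := (((hasDerivAt_id u).pow 2).const_sub 1).sqrt hu0.ne'
    have e' := (((hasDerivAt_id u).const_mul x).const_sub 1).add (e.const_mul (√(1 - x ^ 2)))
    refine e'.congr_deriv ?_
    simp
  have h2 := (((hasDerivAt_id u).sub_const x).log (sub_ne_zero.2 hxu)).sub (h1.log hD.ne')
  refine h2.congr_deriv ?_
  have hs := sq_sqrt hx0.le
  have hc := sq_sqrt hu0.le
  have hc0 : √(1 - u ^ 2) ≠ 0 := (sqrt_pos.2 hu0).ne'
  have hux : u - x ≠ 0 := sub_ne_zero.2 hxu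
  have hD' := hD.ne'
  simp only [id]
  field_simp
  unfold cauchyDen
  generalize √(1 - x ^ 2) = s at *
  generalize √(1 - u ^ 2) = c at *
  linear_combination c * (-hs) + s * hc

theorem integral_cauchyKernel_right {x v : ℝ} (hx : x ∈ Set.Ioo (-1 : ℝ) 1) (hv : v ∈ Set.Ioc x 1) :
    IntervalIntegrable (fun u => √(1 - x ^ 2) / (√(1 - u ^ 2) * (u - x))) volume v 1 ∧
      ∫ u in v..1, √(1 - x ^ 2) / (√(1 - u ^ 2) * (u - x)) =
        log (cauchyDen x v) - log (v - x) := by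
  have hmem : ∀ u ∈ Set.Icc v 1, u ∈ Set.Icc (-1 : ℝ) 1 := fun u hu =>
    ⟨by linarith [hu.1, hv.1, hx.1], hu.2⟩
  obtain ⟨h1, h2⟩ := intervalIntegrable_and_integral_of_deriv_nonneg
    (F := fun u => log (u - x) - log (cauchyDen x u))
    (F' := fun u => √(1 - x ^ 2) / (√(1 - u ^ 2) * (u - x))) hv.2
    (by
      apply ContinuousOn.sub
      · exact ContinuousOn.log (by fun_prop)
          fun u hu => by linarith [hu.1, hv.1, sub_pos.2 (hv.1.trans_le hu.1)] |> ne_of_gt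
      · exact (continuous_cauchyDen x).continuousOn.log
          fun u hu => (cauchyDen_pos hx (hmem u hu)).ne')
    (fun u hu => hasDerivAt_log_sub_log_cauchyDen hx
      ⟨by linarith [hu.1, hv.1, hx.1], hu.2⟩ (hv.1.trans hu.1).ne')
    (fun u hu => div_nonneg (sqrt_nonneg _)
      (mul_nonneg (sqrt_nonneg _) (sub_nonneg.2 (hv.1.trans hu.1).le)))
  refine ⟨h1, h2.trans ?_⟩
  simp [cauchyDen]

theorem integral_cauchyKernel_left {x v : ℝ} (hx : x ∈ Set.Ioo (-1 : ℝ) 1)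
    (hv : v ∈ Set.Ico (-1 : ℝ) x) :
    IntervalIntegrable (fun u => √(1 - x ^ 2) / (√(1 - u ^ 2) * (u - x))) volume (-1) v ∧
      ∫ u in (-1)..v, √(1 - x ^ 2) / (√(1 - u ^ 2) * (u - x)) =
        -(log (cauchyDen x v) - log (x - v)) := by
  obtain ⟨h1, h2⟩ := integral_cauchyKernel_right (x := -x) (v := -v)
    ⟨by linarith [hx.2], by linarith [hx.1]⟩ ⟨by linarith [hv.2], by linarith [hv.1]⟩
  have e : (fun u : ℝ => √(1 - x ^ 2) / (√(1 - u ^ 2) * (u - x))) =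
      fun u => -(√(1 - (-x) ^ 2) / (√(1 - (-u) ^ 2) * (-u - -x))) := by
    funext u
    rw [← div_neg, neg_sq, neg_sq]
    congr 1
    ring
  rw [e]
  refine ⟨?_, ?_⟩
  · have := ((IntervalIntegrable.iff_comp_neg (by simp)).1 h1).symm.neg
    simpa [Pi.neg_def] using this
  · rw [intervalIntegral.integral_neg,
      intervalIntegral.integral_comp_neg (fun u => √(1 - (-x) ^ 2) / (√(1 - u ^ 2) * (u - -x))),
      neg_neg, h2, cauchyDen_neg]
    congr 3
    ring

theorem tendsto_integral_cauchyKernel {x : ℝ} (hx : x ∈ Set.Ioo (-1 : ℝ) 1) :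
    Tendsto (fun ε : ℝ =>
      (∫ u in (-1)..(x - ε), √(1 - x ^ 2) / (√(1 - u ^ 2) * (u - x))) +
        ∫ u in (x + ε)..1, √(1 - x ^ 2) / (√(1 - u ^ 2) * (u - x)))
      (𝓝[>] 0) (𝓝 0) := by
  have hpos := cauchyDen_pos hx (Set.Ioo_subset_Icc_self hx)
  have hlim : Tendsto (fun ε : ℝ => log (cauchyDen x (x + ε)) - log (cauchyDen x (x - ε)))
      (𝓝[>] 0) (𝓝 0) := by
    have hc : ContinuousAt
        (fun ε : ℝ => log (cauchyDen x (x + ε)) - log (cauchyDen x (x - ε))) 0 := by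
      have hD := continuous_cauchyDen x
      apply ContinuousAt.sub
      · exact ContinuousAt.log (by fun_prop) (by simpa using hpos.ne')
      · exact ContinuousAt.log (by fun_prop) (by simpa using hpos.ne')
    have := hc.tendsto
    simp only [add_zero, sub_zero, sub_self] at this
    exact this.mono_left nhdsWithin_le_nhds
  refine hlim.congr' ?_
  have hm : 0 < min (x + 1) (1 - x) := lt_min (by linarith [hx.1]) (by linarith [hx.2])
  filter_upwards [Ioo_mem_nhdsGT hm] with ε hε
  have h1 := hε.2.trans_le (min_le_left _ _)
  have h2 := hε.2.trans_le (min_le_right _ _)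
  rw [(integral_cauchyKernel_left hx ⟨by linarith, by linarith [hε.1]⟩).2,
    (integral_cauchyKernel_right hx ⟨by linarith [hε.1], by linarith⟩).2,
    sub_sub_cancel, add_sub_cancel_left]
  ring

theorem abs_weighted_integral_right_le {x L C δ : ℝ} (hx : x ∈ Set.Ioo (-1 : ℝ) 1) (hL : 0 ≤ L)
    (hC : 0 ≤ C) (hδ : 0 < δ) (hδ2 : δ ≤ 2) {q : ℝ → ℝ}
    (hi : IntervalIntegrable (fun u => q u / √(1 - u ^ 2)) volume x 1)
    (hqL : ∀ u ∈ Set.Ioc x 1, |q u| ≤ L) (hqC : ∀ u ∈ Set.Ioc x 1, |q u| * (u - x) ≤ C) :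
    √(1 - x ^ 2) * |∫ u in x..1, q u / √(1 - u ^ 2)| ≤ 2 * L * δ + C * log (2 / δ) := by
  have hs := sqrt_nonneg (1 - x ^ 2)
  have near : ∀ v ∈ Set.Ioc x 1,
      √(1 - x ^ 2) * |∫ u in x..v, q u / √(1 - u ^ 2)| ≤ 2 * L * (v - x) := by
    intro v hv
    obtain ⟨h1, h2⟩ := integral_sqrt_one_sub_div_sqrt hv.1.le hv.2
    rw [← abs_of_nonneg hs, ← abs_mul, ← intervalIntegral.integral_const_mul, ← norm_eq_abs]
    refine (intervalIntegral.norm_integral_le_of_norm_le hv.1.le (Eventually.of_forall ?_)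
      (h1.const_mul L)).trans ?_
    · intro u hu
      have e := sqrt_div_sqrt_one_sub_sq_le hx.1 hu.1.le (hu.2.trans hv.2)
      rw [norm_eq_abs, mul_div_left_comm, abs_mul,
        abs_of_nonneg (div_nonneg hs (sqrt_nonneg (1 - u ^ 2)))]
      exact mul_le_mul (hqL u ⟨hu.1, hu.2.trans hv.2⟩) e (by positivity) hL
    · rw [intervalIntegral.integral_const_mul]
      nlinarith
  have hlog : 0 ≤ log (2 / δ) := log_nonneg ((one_le_div hδ).2 hδ2)
  rcases le_total 1 (x + δ) with h | h
  · have := near 1 ⟨hx.2, le_rfl⟩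
    have : 0 ≤ C * log (2 / δ) := by positivity
    nlinarith
  have hv : x + δ ∈ Set.Ioc x 1 := ⟨by linarith, h⟩
  have far : √(1 - x ^ 2) * |∫ u in (x + δ)..1, q u / √(1 - u ^ 2)| ≤ C * log (2 / δ) := by
    obtain ⟨h1, h2⟩ := integral_cauchyKernel_right hx hv
    rw [← abs_of_nonneg hs, ← abs_mul, ← intervalIntegral.integral_const_mul, ← norm_eq_abs]
    refine (intervalIntegral.norm_integral_le_of_norm_le h (Eventually.of_forall ?_)
      (h1.const_mul C)).trans ?_
    · intro u hu
      have hxu : 0 < u - x := by linarith [hu.1]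
      have e := hqC u ⟨by linarith, hu.2⟩
      rw [norm_eq_abs, mul_div_left_comm, abs_mul,
        abs_of_nonneg (div_nonneg hs (sqrt_nonneg (1 - u ^ 2))), ← div_div, ← mul_div_assoc C,
        le_div_iff₀ hxu, mul_right_comm]
      exact mul_le_mul_of_nonneg_right e (by positivity)
    · rw [intervalIntegral.integral_const_mul, h2, add_sub_cancel_left]
      have hm : x + δ ∈ Set.Icc (-1 : ℝ) 1 := ⟨by linarith [hx.1], h⟩
      rw [log_div two_ne_zero hδ.ne']
      gcongr
      · exact cauchyDen_pos hx hm
      · exact cauchyDen_le_two hx hm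
  have i1 : IntervalIntegrable (fun u => q u / √(1 - u ^ 2)) volume x (x + δ) :=
    hi.mono_set (by
      rw [Set.uIcc_of_le hv.1.le, Set.uIcc_of_le hx.2.le]
      exact Set.Icc_subset_Icc_right h)
  have i2 : IntervalIntegrable (fun u => q u / √(1 - u ^ 2)) volume (x + δ) 1 :=
    hi.mono_set (by
      rw [Set.uIcc_of_le h, Set.uIcc_of_le hx.2.le]
      exact Set.Icc_subset_Icc_left hv.1.le)
  rw [← intervalIntegral.integral_add_adjacent_intervals i1 i2]
  have n := near _ hv
  rw [add_sub_cancel_left] at n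
  calc _ ≤ √(1 - x ^ 2) * (|∫ u in x..(x + δ), q u / √(1 - u ^ 2)| +
        |∫ u in (x + δ)..1, q u / √(1 - u ^ 2)|) :=
        mul_le_mul_of_nonneg_left (abs_add_le _ _) hs
    _ ≤ _ := by rw [mul_add]; exact add_le_add n far

theorem abs_weighted_integral_left_le {x L C δ : ℝ} (hx : x ∈ Set.Ioo (-1 : ℝ) 1) (hL : 0 ≤ L)
    (hC : 0 ≤ C) (hδ : 0 < δ) (hδ2 : δ ≤ 2) {q : ℝ → ℝ}
    (hi : IntervalIntegrable (fun u => q u / √(1 - u ^ 2)) volume (-1) x)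
    (hqL : ∀ u ∈ Set.Ico (-1) x, |q u| ≤ L) (hqC : ∀ u ∈ Set.Ico (-1) x, |q u| * (x - u) ≤ C) :
    √(1 - x ^ 2) * |∫ u in (-1)..x, q u / √(1 - u ^ 2)| ≤ 2 * L * δ + C * log (2 / δ) := by
  have key := abs_weighted_integral_right_le (x := -x) (q := fun u => q (-u))
    ⟨by linarith [hx.2], by linarith [hx.1]⟩ hL hC hδ hδ2
    (by simpa using ((IntervalIntegrable.iff_comp_neg (by simp)).1 hi).symm)
    (fun u hu => hqL (-u) ⟨by linarith [hu.2], by linarith [hu.1]⟩)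
    (fun u hu => by
      have := hqC (-u) ⟨by linarith [hu.2], by linarith [hu.1]⟩
      rwa [show x - -u = u - -x by ring] at this)
  have e := intervalIntegral.integral_comp_neg (a := -x) (b := 1)
    (fun u => q u / √(1 - u ^ 2))
  simp only [neg_sq, neg_neg] at e key
  rwa [e] at key

/-- The principal value of a Lipschitz function against the weighted Cauchy kernel exists; it is
bounded by splitting the integral of the difference quotient at distance `δ` from the pole. -/
theorem exists_tendsto_cauchy_of_lipschitz {x L B δ : ℝ} (hx : x ∈ Set.Ioo (-1 : ℝ) 1)
    (hL : 0 ≤ L) (hB : 0 ≤ B) (hδ : 0 < δ) (hδ2 : δ ≤ 2) {φ : ℝ → ℝ}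
    (hφL : ∀ u ∈ Set.Icc (-1 : ℝ) 1, ∀ v ∈ Set.Icc (-1 : ℝ) 1, |φ u - φ v| ≤ L * |u - v|)
    (hφB : ∀ u ∈ Set.Icc (-1 : ℝ) 1, |φ u| ≤ B) :
    ∃ I : ℝ, Tendsto (fun ε : ℝ =>
        (∫ u in (-1 : ℝ)..(x - ε), φ u / (√(1 - u ^ 2) * (u - x))) +
          ∫ u in (x + ε)..(1 : ℝ), φ u / (√(1 - u ^ 2) * (u - x))) (𝓝[>] 0) (𝓝 I) ∧
      √(1 - x ^ 2) * |I| ≤ 4 * L * δ + 4 * B * log (2 / δ) := by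
  have hxm := Set.Ioo_subset_Icc_self hx
  have hs : 0 < √(1 - x ^ 2) := sqrt_pos.2 (by nlinarith [hx.1, hx.2])
  set q : ℝ → ℝ := fun u => (φ u - φ x) / (u - x) with hq
  have hφc : ContinuousOn φ (Set.Icc (-1) 1) := by
    refine LipschitzOnWith.continuousOn (K := L.toNNReal) (LipschitzOnWith.of_dist_le_mul ?_)
    intro u hu v hv
    rw [Real.coe_toNNReal _ hL]
    exact hφL u hu v hv
  have hqL : ∀ u ∈ Set.Icc (-1 : ℝ) 1, |q u| ≤ L := by
    intro u hu
    rw [hq, abs_div]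
    exact div_le_of_le_mul₀ (abs_nonneg _) hL (hφL u hu x hxm)
  have hqB : ∀ u ∈ Set.Icc (-1 : ℝ) 1, |q u| * |u - x| ≤ 2 * B := by
    intro u hu
    have h1 := hφB u hu
    have h2 := hφB x hxm
    rw [← abs_mul]
    rcases eq_or_ne u x with rfl | hux
    · simpa using hB
    · rw [hq, div_mul_cancel₀ _ (sub_ne_zero.2 hux)]
      linarith [abs_sub (φ u) (φ x)]
  have hqi : IntervalIntegrable (fun u => q u / √(1 - u ^ 2)) volume (-1) 1 := by
    have h0 := intervalIntegrable_one_div_sqrt_one_sub_sq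
    rw [intervalIntegrable_iff_integrableOn_Ioc_of_le (by norm_num)] at h0 ⊢
    have hm : AEStronglyMeasurable q (volume.restrict (Set.Ioc (-1) 1)) := by
      have h1 : AEMeasurable φ (volume.restrict (Set.Ioc (-1) 1)) :=
        (hφc.mono Set.Ioc_subset_Icc_self).aemeasurable measurableSet_Ioc
      exact ((h1.sub_const _).div (by fun_prop)).aestronglyMeasurable
    have := Integrable.bdd_mul (c := L) h0 hm
      ((ae_restrict_mem measurableSet_Ioc).mono fun u hu => hqL u (Set.Ioc_subset_Icc_self hu))
    simp only [mul_one_div] at this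
    exact this
  have hsub : ∀ a ∈ Set.Icc (-1 : ℝ) 1, ∀ b ∈ Set.Icc (-1 : ℝ) 1,
      IntervalIntegrable (fun u => q u / √(1 - u ^ 2)) volume a b := fun a ha b hb =>
    hqi.mono_set (by
      rw [Set.uIcc_of_le (show (-1 : ℝ) ≤ 1 by norm_num)]
      exact Set.uIcc_subset_Icc ha hb)
  have hl : (-1 : ℝ) ∈ Set.Icc (-1 : ℝ) 1 := by norm_num
  have hr : (1 : ℝ) ∈ Set.Icc (-1 : ℝ) 1 := by norm_num
  refine ⟨(∫ u in (-1)..x, q u / √(1 - u ^ 2)) + ∫ u in x..1, q u / √(1 - u ^ 2), ?_, ?_⟩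
  · have hprim : Tendsto (fun ε : ℝ => (∫ u in (-1)..(x - ε), q u / √(1 - u ^ 2)) +
        ∫ u in (x + ε)..1, q u / √(1 - u ^ 2)) (𝓝[>] 0)
        (𝓝 ((∫ u in (-1)..x, q u / √(1 - u ^ 2)) + ∫ u in x..1, q u / √(1 - u ^ 2))) := by
      have hint : IntegrableOn (fun u => q u / √(1 - u ^ 2)) (Set.uIcc (-1) 1) := by
        rwa [Set.uIcc_of_le (by norm_num), integrableOn_Icc_iff_integrableOn_Ioc,
          ← intervalIntegrable_iff_integrableOn_Ioc_of_le (by norm_num)]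
      have hnhds : Set.uIcc (-1 : ℝ) 1 ∈ 𝓝 x := by
        rw [Set.uIcc_of_le (by norm_num)]
        exact Icc_mem_nhds hx.1 hx.2
      have c1 := (intervalIntegral.continuousOn_primitive_interval hint).continuousAt hnhds
      have c2 := (intervalIntegral.continuousOn_primitive_interval_left hint).continuousAt hnhds
      have t1 : Tendsto (fun ε : ℝ => x - ε) (𝓝[>] 0) (𝓝 x) := by
        have : Tendsto (fun ε : ℝ => x - ε) (𝓝 0) (𝓝 (x - 0)) := by
          exact (continuous_const.sub continuous_id).tendsto 0
        rw [sub_zero] at this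
        exact this.mono_left nhdsWithin_le_nhds
      have t2 : Tendsto (fun ε : ℝ => x + ε) (𝓝[>] 0) (𝓝 x) := by
        have : Tendsto (fun ε : ℝ => x + ε) (𝓝 0) (𝓝 (x + 0)) := by
          exact (continuous_const.add continuous_id).tendsto 0
        rw [add_zero] at this
        exact this.mono_left nhdsWithin_le_nhds
      exact (c1.tendsto.comp t1).add (c2.tendsto.comp t2)
    have hsum := hprim.add ((tendsto_integral_cauchyKernel hx).const_mul (φ x / √(1 - x ^ 2)))
    rw [mul_zero, add_zero] at hsum
    refine hsum.congr' ?_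
    have hm : 0 < min (x + 1) (1 - x) := lt_min (by linarith [hx.1]) (by linarith [hx.2])
    filter_upwards [Ioo_mem_nhdsGT hm] with ε hε
    have h1 := hε.2.trans_le (min_le_left _ _)
    have h2 := hε.2.trans_le (min_le_right _ _)
    have h0 := hε.1
    have split : ∀ u : ℝ, u ≠ x → φ u / (√(1 - u ^ 2) * (u - x)) = q u / √(1 - u ^ 2) +
        φ x / √(1 - x ^ 2) * (√(1 - x ^ 2) / (√(1 - u ^ 2) * (u - x))) := by
      intro u hu
      rw [div_mul_div_cancel₀ hs.ne', hq, div_div, mul_comm (u - x), ← add_div, sub_add_cancel]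
    have k1 := (integral_cauchyKernel_left hx (v := x - ε) ⟨by linarith, by linarith⟩).1
    have k2 := (integral_cauchyKernel_right hx (v := x + ε) ⟨by linarith, by linarith⟩).1
    have e1 : ∫ u in (-1 : ℝ)..(x - ε), φ u / (√(1 - u ^ 2) * (u - x)) =
        (∫ u in (-1 : ℝ)..(x - ε), q u / √(1 - u ^ 2)) + φ x / √(1 - x ^ 2) *
          ∫ u in (-1 : ℝ)..(x - ε), √(1 - x ^ 2) / (√(1 - u ^ 2) * (u - x)) := by
      rw [← intervalIntegral.integral_const_mul, ← intervalIntegral.integral_add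
        (hsub _ hl _ ⟨by linarith, by linarith [hx.2]⟩) (k1.const_mul _)]
      refine intervalIntegral.integral_congr fun u hu => split u ?_
      rw [Set.uIcc_of_le (by linarith)] at hu
      exact (hu.2.trans_lt (by linarith)).ne
    have e2 : ∫ u in (x + ε)..1, φ u / (√(1 - u ^ 2) * (u - x)) =
        (∫ u in (x + ε)..1, q u / √(1 - u ^ 2)) + φ x / √(1 - x ^ 2) *
          ∫ u in (x + ε)..1, √(1 - x ^ 2) / (√(1 - u ^ 2) * (u - x)) := by
      rw [← intervalIntegral.integral_const_mul, ← intervalIntegral.integral_add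
        (hsub _ ⟨by linarith [hx.1], by linarith⟩ _ hr) (k2.const_mul _)]
      refine intervalIntegral.integral_congr fun u hu => split u ?_
      rw [Set.uIcc_of_le (by linarith)] at hu
      exact (lt_of_lt_of_le (by linarith) hu.1).ne'
    rw [e1, e2]
    ring
  · have r := abs_weighted_integral_right_le hx hL (mul_nonneg zero_le_two hB) hδ hδ2
      (hsub x hxm 1 hr) (fun u hu => hqL u ⟨hx.1.le.trans hu.1.le, hu.2⟩) (fun u hu => by
        have := hqB u ⟨hx.1.le.trans hu.1.le, hu.2⟩
        rwa [abs_of_pos (sub_pos.2 hu.1)] at this)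
    have l := abs_weighted_integral_left_le hx hL (mul_nonneg zero_le_two hB) hδ hδ2
      (hsub (-1) hl x hxm) (fun u hu => hqL u ⟨hu.1, hu.2.le.trans hx.2.le⟩) (fun u hu => by
        have := hqB u ⟨hu.1, hu.2.le.trans hx.2.le⟩
        rwa [abs_sub_comm, abs_of_pos (sub_pos.2 hu.2)] at this)
    have := mul_le_mul_of_nonneg_left (abs_add_le (∫ u in (-1)..x, q u / √(1 - u ^ 2))
      (∫ u in x..1, q u / √(1 - u ^ 2))) hs.le
    linarith

theorem sixteen_le_pi_mul_sqrt : 16 ≤ π * √(24 * π) := by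
  have h := pi_gt_three
  have : (8 : ℝ) ≤ √(24 * π) := le_sqrt_of_sq_le (by linarith)
  nlinarith

theorem sq_mul_one_add_log_le {H h n a : ℝ} (hH : 0 < H) (hHh : H ≤ h) (hn : 1 ≤ n)
    (ha : 16 ≤ a) : H ^ 2 * (1 + log (16 / H)) ≤ h ^ 2 * log n + a * (h / n) := by
  have hn0 : 0 < n := by linarith
  have hlog := log_nonneg hn
  have h1 : 1 + log (16 / H) ≤ log n + 16 / (H * n) := by
    have := log_le_sub_one_of_pos (show 0 < 16 / (H * n) by positivity)
    rw [← div_div, log_div (by positivity) hn0.ne'] at this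
    rw [← div_div]
    linarith
  calc H ^ 2 * (1 + log (16 / H)) ≤ H ^ 2 * (log n + 16 / (H * n)) := by gcongr
    _ = H ^ 2 * log n + 16 * (H / n) := by field_simp
    _ ≤ h ^ 2 * log n + a * (h / n) := by gcongr

theorem quadrature_error_CW2_table3
    (N : ℕ) (hN : 3 ≤ N)
    (t : ℕ → ℝ) (ht0 : t 0 = -1) (htN : t N = 1)
    (hmono : ∀ k, k < N → t k < t (k + 1))
    (γ : ℝ) (hγ : 0 < γ)
    (hstep : ∀ k, k < N → t (k + 1) - t k ≤ γ / N)
    (f S : ℝ → ℝ) (M₂ : ℝ)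
    (hfc : ContinuousOn f (Set.Icc (-1 : ℝ) 1))
    (hf : ∀ k, k < N → ∃ g : ℝ → ℝ,
      (∀ u ∈ Set.Icc (t k) (t (k + 1)),
        HasDerivWithinAt f (g u) (Set.Icc (t k) (t (k + 1))) u) ∧
      (∀ u ∈ Set.Icc (t k) (t (k + 1)), ∀ v ∈ Set.Icc (t k) (t (k + 1)),
        |g u - g v| ≤ M₂ * |u - v|))
    (hS : ∀ k, k < N → ∀ u ∈ Set.Icc (t k) (t (k + 1)),
      S u = ((t (k + 1) - u) * f (t k) + (u - t k) * f (t (k + 1))) / (t (k + 1) - t k))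
    (x : ℝ) (hx : x ∈ Set.Ioo (-1 : ℝ) 1) :
    ∃ I : ℝ,
      Tendsto (fun ε : ℝ =>
          (∫ u in (-1 : ℝ)..(x - ε), (f u - S u) / (Real.sqrt (1 - u ^ 2) * (u - x))) +
          ∫ u in (x + ε)..(1 : ℝ), (f u - S u) / (Real.sqrt (1 - u ^ 2) * (u - x)))
        (𝓝[>] (0 : ℝ)) (𝓝 I) ∧
      |Real.sqrt (1 - x ^ 2) / π * I| ≤
        (γ ^ 2 * M₂ / (2 * π)) * (1 + π * Real.sqrt (24 * π) / (γ * Real.log N)) *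
          Real.log N / N ^ 2 := by
  have hN0 : (0 : ℝ) < N := by positivity
  have hN1 : (1 : ℝ) < N := by exact_mod_cast (by omega : 1 < N)
  have hlogN : 0 < log N := log_pos hN1
  obtain ⟨H, hHdef⟩ : ∃ H, H = min (γ / N) 2 := ⟨_, rfl⟩
  have hH : 0 < H := hHdef ▸ lt_min (by positivity) two_pos
  have hHγ : H ≤ γ / N := hHdef ▸ min_le_left _ _
  have hH2 : H ≤ 2 := hHdef ▸ min_le_right _ _
  have hmon : ∀ j ≤ N, ∀ i ≤ j, t i ≤ t j := by
    intro j
    induction j with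
    | zero => intro _ i hi; rw [Nat.le_zero.1 hi]
    | succ j ih =>
      intro hj i hi
      rcases Nat.le_succ_iff.1 hi with h | rfl
      · exact (ih (by omega) i h).trans (hmono j (by omega)).le
      · rfl
  have hstepH : ∀ k < N, t (k + 1) - t k ≤ H := by
    intro k hk
    rw [hHdef]
    refine le_min (hstep k hk) ?_
    have h1 := hmon N le_rfl (k + 1) hk
    have h2 := hmon k hk.le 0 (Nat.zero_le k)
    linarith
  have hM : 0 ≤ M₂ := by
    obtain ⟨g, -, hg⟩ := hf 0 (by omega)
    have h01 := hmono 0 (by omega)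
    have := (abs_nonneg _).trans (hg _ (Set.left_mem_Icc.2 h01.le) _ (Set.right_mem_Icc.2 h01.le))
    exact nonneg_of_mul_nonneg_left this (abs_pos.2 (sub_ne_zero.2 h01.ne))
  have hpiece : ∀ k < N, ∃ p : ℝ → ℝ,
      (∀ u ∈ Set.Icc (t k) (t (k + 1)), HasDerivWithinAt (fun u => f u - S u) (p u)
        (Set.Icc (t k) (t (k + 1))) u) ∧
      (∀ u ∈ Set.Icc (t k) (t (k + 1)), ∀ v ∈ Set.Icc (t k) (t (k + 1)),
        |p u - p v| ≤ M₂ * |u - v|) ∧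
      f (t k) - S (t k) = 0 ∧ f (t (k + 1)) - S (t (k + 1)) = 0 := by
    intro k hk
    obtain ⟨g, hg, hgL⟩ := hf k hk
    have hk' := hmono k hk
    have hne : t (k + 1) - t k ≠ 0 := (sub_pos.2 hk').ne'
    refine ⟨fun u => g u - (f (t (k + 1)) - f (t k)) / (t (k + 1) - t k), fun u hu => ?_, ?_, ?_, ?_⟩
    · refine (hg u hu).sub (HasDerivWithinAt.congr (f := fun u =>
        ((t (k + 1) - u) * f (t k) + (u - t k) * f (t (k + 1))) / (t (k + 1) - t k)) ?_
        (hS k hk) (hS k hk u hu))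
      have := ((((hasDerivAt_id u).const_sub (t (k + 1))).mul_const (f (t k))).add
        (((hasDerivAt_id u).sub_const (t k)).mul_const (f (t (k + 1))))).div_const (t (k + 1) - t k)
      exact (this.congr_deriv (by ring)).hasDerivWithinAt
    · intro u hu v hv
      simpa using hgL u hu v hv
    · rw [hS k hk _ (Set.left_mem_Icc.2 hk'.le)]
      field_simp
      ring
    · rw [hS k hk _ (Set.right_mem_Icc.2 hk'.le)]
      field_simp
      ring
  have hlip : ∀ u ∈ Set.Icc (-1 : ℝ) 1, ∀ v ∈ Set.Icc (-1 : ℝ) 1,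
      |(f u - S u) - (f v - S v)| ≤ M₂ * H * |u - v| := by
    rw [← ht0, ← htN]
    refine abs_sub_le_of_pieces (φ := fun u => f u - S u) hmono fun k hk u hu v hv => ?_
    obtain ⟨p, hp, hpL, h0, h1⟩ := hpiece k hk
    refine (abs_sub_le_of_lipschitz_deriv hM (hmono k hk) hp hpL (h0.trans h1.symm) hu hv).trans ?_
    have := hstepH k hk
    gcongr
  have hbdd : ∀ u ∈ Set.Icc (-1 : ℝ) 1, |f u - S u| ≤ M₂ * H ^ 2 / 8 := by
    intro u hu
    rw [← ht0, ← htN] at hu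
    obtain ⟨k, hk, hku⟩ := exists_piece_of_mem_Icc (by omega) hu
    obtain ⟨p, hp, hpL, h0, h1⟩ := hpiece k hk
    refine (abs_le_of_lipschitz_deriv hM hp hpL h0 h1 hku).trans ?_
    have h2 := hstepH k hk
    have h3 := sub_nonneg.2 (hmono k hk).le
    gcongr
  obtain ⟨I, hI, hIle⟩ := exists_tendsto_cauchy_of_lipschitz (δ := H / 8) hx (by positivity)
    (by positivity) (by positivity) (by linarith) hlip hbdd
  refine ⟨I, hI, ?_⟩
  have hπ := pi_pos
  have hfin := sq_mul_one_add_log_le hH hHγ hN1.le sixteen_le_pi_mul_sqrt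
  rw [show 2 / (H / 8) = 16 / H by field_simp; norm_num] at hIle
  rw [abs_mul, abs_of_nonneg (by positivity)]
  calc √(1 - x ^ 2) / π * |I| = √(1 - x ^ 2) * |I| / π := by ring
    _ ≤ (M₂ / 2 * (H ^ 2 * (1 + log (16 / H)))) / π := by
      refine div_le_div_of_nonneg_right ?_ hπ.le
      linarith
    _ ≤ (M₂ / 2 * ((γ / N) ^ 2 * log N + π * √(24 * π) * (γ / N / N))) / π := by gcongr
    _ = _ := by field_simp
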